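/- Let A ∈ B(H). Then w(A)² = (1/4)‖A*A + AA*‖ if and only if ‖Re(e^{iθ}A)‖² = ‖Im(e^{iθ}A)‖² = (1/4)‖A*A + AA*‖ for all θ ∈ ℝ. -/

import Mathlib

open ContinuousLinearMap Filter
open scoped ComplexInnerProductSpace Topology

variable {H : Type*} [NormedAddCommGroup H] [InnerProductSpace ℂ H]
  [CompleteSpace H] [Nontrivial H]

/-- The numerical range of a bounded linear operator. -/
noncomputable def numRange (A : H →L[ℂ] H) : Set ℂ :=
  {z : ℂ | ∃ x : H, ‖x‖ = 1 ∧ z = ⟪x, A x⟫}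

/-- The numerical radius of a bounded linear operator. -/
noncomputable def numRadius (A : H →L[ℂ] H) : ℝ :=
  sSup {r : ℝ | ∃ x : H, ‖x‖ = 1 ∧ r = ‖(⟪x, A x⟫)‖}

/-- The Crawford number of a bounded linear operator. -/
noncomputable def crawford (A : H →L[ℂ] H) : ℝ :=
  sInf {r : ℝ | ∃ x : H, ‖x‖ = 1 ∧ r = ‖(⟪x, A x⟫)‖}

/-- The real part `(A + A*)/2` of a bounded linear operator. -/
noncomputable def reOp (A : H →L[ℂ] H) : H →L[ℂ] H :=
  (2 : ℂ)⁻¹ • (A + ContinuousLinearMap.adjoint A)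

/-- The imaginary part `(A - A*)/(2i)` of a bounded linear operator. -/
noncomputable def imOp (A : H →L[ℂ] H) : H →L[ℂ] H :=
  (2 * Complex.I)⁻¹ • (A - ContinuousLinearMap.adjoint A)

omit [CompleteSpace H] [Nontrivial H] in
/-- The set whose supremum is the numerical radius is bounded above. -/
theorem bddAbove_norm_inner (A : H →L[ℂ] H) :
    BddAbove {r : ℝ | ∃ x : H, ‖x‖ = 1 ∧ r = ‖(⟪x, A x⟫)‖} := by
  refine ⟨‖A‖, ?_⟩
  rintro _ ⟨x, hx, rfl⟩
  have h := (norm_inner_le_norm (𝕜 := ℂ) x (A x)).trans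
    (mul_le_mul_of_nonneg_left (A.le_opNorm x) (norm_nonneg x))
  simpa [hx] using h

omit [CompleteSpace H] [Nontrivial H] in
theorem norm_inner_le_numRadius (A : H →L[ℂ] H) {x : H} (hx : ‖x‖ = 1) :
    ‖(⟪x, A x⟫)‖ ≤ numRadius A :=
  le_csSup (bddAbove_norm_inner A) ⟨x, hx, rfl⟩

omit [CompleteSpace H] in
theorem numRadius_le {A : H →L[ℂ] H} {M : ℝ} (h : ∀ x : H, ‖x‖ = 1 → ‖(⟪x, A x⟫)‖ ≤ M) :
    numRadius A ≤ M := by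
  obtain ⟨x, hx⟩ := exists_norm_eq H zero_le_one
  refine csSup_le ⟨_, x, hx, rfl⟩ ?_
  rintro _ ⟨y, hy, rfl⟩
  exact h y hy

omit [CompleteSpace H] [Nontrivial H] in
theorem numRadius_nonneg (A : H →L[ℂ] H) : 0 ≤ numRadius A :=
  Real.sSup_nonneg (by rintro _ ⟨x, -, rfl⟩; exact norm_nonneg _)

omit [Nontrivial H] in
/-- The norm of a self-adjoint operator is bounded by any bound of its quadratic form on the unit
sphere. -/
theorem IsSelfAdjoint.norm_le_of_norm_inner_le {B : H →L[ℂ] H} (hB : IsSelfAdjoint B) {M : ℝ}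
    (hM : 0 ≤ M) (h : ∀ x : H, ‖x‖ = 1 → ‖(⟪x, B x⟫)‖ ≤ M) : ‖B‖ ≤ M := by
  rw [B.norm_eq_iSup_rayleighQuotient hB.isSymmetric]
  refine ciSup_le fun x ↦ ?_
  rcases eq_or_ne x 0 with rfl | hx
  · simpa using hM
  · have hx' : ‖x‖ ≠ 0 := norm_ne_zero_iff.mpr hx
    have hc : ((‖x‖⁻¹ : ℝ) : ℂ) ≠ 0 := by simpa using hx
    have hu : ‖((‖x‖⁻¹ : ℝ) : ℂ) • x‖ = 1 := by simp [norm_smul, hx']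
    rw [← B.rayleigh_smul x hc, rayleighQuotient, hu, one_pow, div_one, reApplyInnerSelf_apply,
      inner_re_symm]
    exact (RCLike.abs_re_le_norm _).trans (h _ hu)

omit [Nontrivial H] in
theorem isSelfAdjoint_reOp (A : H →L[ℂ] H) : IsSelfAdjoint (reOp A) := by
  rw [isSelfAdjoint_iff, star_eq_adjoint, reOp]
  simp [map_smulₛₗ, map_ofNat, add_comm]

omit [Nontrivial H] in
theorem inner_reOp (A : H →L[ℂ] H) (x : H) : ⟪x, reOp A x⟫ = ((⟪x, A x⟫).re : ℂ) := by
  rw [Complex.re_eq_add_conj, inner_conj_symm]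
  simp [reOp, adjoint_inner_right]
  ring

omit [Nontrivial H] in
theorem imOp_eq_reOp (A : H →L[ℂ] H) : imOp A = reOp ((-Complex.I) • A) := by
  have h : (2 * Complex.I)⁻¹ = (2 : ℂ)⁻¹ * -Complex.I := by simp [mul_comm]
  rw [imOp, reOp, h, mul_smul, map_smulₛₗ]
  simp [sub_eq_add_neg]

omit [Nontrivial H] in
/-- The norm of the real part of a unimodular multiple is at most the numerical radius. -/
theorem norm_reOp_smul_le_numRadius (A : H →L[ℂ] H) {c : ℂ} (hc : ‖c‖ = 1) :
    ‖reOp (c • A)‖ ≤ numRadius A := by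
  refine (isSelfAdjoint_reOp _).norm_le_of_norm_inner_le (numRadius_nonneg A) fun x hx ↦ ?_
  rw [inner_reOp, Complex.norm_real]
  refine (Complex.abs_re_le_norm _).trans ?_
  simpa [inner_smul_right, hc] using norm_inner_le_numRadius A hx

omit [Nontrivial H] in
/-- The squares of the real and imaginary parts of an operator sum to `(A*A + AA*)/2`. -/
theorem reOp_sq_add_imOp_sq (A : H →L[ℂ] H) :
    reOp A ∘L reOp A + imOp A ∘L imOp A =
      (2 : ℂ)⁻¹ • (adjoint A ∘L A + A ∘L adjoint A) := by
  have hI : Complex.I⁻¹ ^ 2 = -1 := by simp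
  simp only [reOp, imOp, smul_comp, comp_smul, add_comp, comp_add, sub_comp, comp_sub]
  match_scalars <;> ring_nf <;> norm_num [hI]

omit [Nontrivial H] in
theorem adjoint_comp_add_smul (A : H →L[ℂ] H) {c : ℂ} (hc : ‖c‖ = 1) :
    adjoint (c • A) ∘L (c • A) + (c • A) ∘L adjoint (c • A) =
      adjoint A ∘L A + A ∘L adjoint A := by
  have h : starRingEnd ℂ c * c = 1 := by simp [Complex.conj_mul', hc]
  simp [map_smulₛₗ, smul_comp, smul_smul, h, mul_comm c]

omit [Nontrivial H] in
theorem half_norm_le_norm_reOp_sq_add_norm_imOp_sq (A : H →L[ℂ] H) :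
    1 / 2 * ‖adjoint A ∘L A + A ∘L adjoint A‖ ≤ ‖reOp A‖ ^ 2 + ‖imOp A‖ ^ 2 := by
  have h := congrArg norm (reOp_sq_add_imOp_sq A)
  rw [norm_smul] at h
  have h2 : ‖(2 : ℂ)⁻¹‖ = 1 / 2 := by norm_num
  rw [← h2, ← h, sq, sq]
  exact (norm_add_le _ _).trans (add_le_add (opNorm_comp_le _ _) (opNorm_comp_le _ _))

/-- The numerical radius is bounded by any bound of the norms of the rotated real parts. -/
theorem numRadius_le_of_norm_reOp_le {A : H →L[ℂ] H} {M : ℝ}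
    (h : ∀ θ : ℝ, ‖reOp (Complex.exp (θ * Complex.I) • A)‖ ≤ M) : numRadius A ≤ M := by
  refine numRadius_le fun x hx ↦ ?_
  set z : ℂ := ⟪x, A x⟫ with hz
  refine le_trans ?_ (h (-z.arg))
  have hrot : Complex.exp ((-z.arg : ℝ) * Complex.I) * z = ‖z‖ := by
    have hexp : Complex.exp ((-z.arg : ℝ) * Complex.I) * Complex.exp (z.arg * Complex.I) = 1 := by
      rw [← Complex.exp_add]
      simp
    calc _ = Complex.exp ((-z.arg : ℝ) * Complex.I) *
          (‖z‖ * Complex.exp (z.arg * Complex.I)) := by rw [Complex.norm_mul_exp_arg_mul_I]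
      _ = ‖z‖ := by rw [mul_left_comm, hexp, mul_one]
  have hin := inner_reOp (Complex.exp ((-z.arg : ℝ) * Complex.I) • A) x
  rw [smul_apply, inner_smul_right, ← hz, hrot, Complex.ofReal_re] at hin
  calc ‖z‖ = ‖(⟪x, reOp (Complex.exp ((-z.arg : ℝ) * Complex.I) • A) x⟫)‖ := by rw [hin]; simp
    _ ≤ ‖x‖ * ‖reOp (Complex.exp ((-z.arg : ℝ) * Complex.I) • A) x‖ := norm_inner_le_norm _ _
    _ ≤ ‖reOp (Complex.exp ((-z.arg : ℝ) * Complex.I) • A)‖ := by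
      simpa [hx] using le_opNorm (reOp (Complex.exp ((-z.arg : ℝ) * Complex.I) • A)) x

/-- `w(A)² = (1/4)‖A*A + AA*‖` iff
`‖Re(e^{iθ}A)‖² = ‖Im(e^{iθ}A)‖² = (1/4)‖A*A + AA*‖` for all `θ ∈ ℝ`. -/
theorem stmt12 (A : H →L[ℂ] H) :
    numRadius A ^ 2 = (1 / 4) * ‖adjoint A ∘L A + A ∘L adjoint A‖ ↔
      ∀ θ : ℝ,
        ‖reOp (Complex.exp (θ * Complex.I) • A)‖ ^ 2 =
          (1 / 4) * ‖adjoint A ∘L A + A ∘L adjoint A‖ ∧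
        ‖imOp (Complex.exp (θ * Complex.I) • A)‖ ^ 2 =
          (1 / 4) * ‖adjoint A ∘L A + A ∘L adjoint A‖ := by
  constructor
  · intro hw θ
    have hc := Complex.norm_exp_ofReal_mul_I θ
    have hsum := half_norm_le_norm_reOp_sq_add_norm_imOp_sq (Complex.exp (θ * Complex.I) • A)
    rw [adjoint_comp_add_smul A hc] at hsum
    have hre := pow_le_pow_left₀ (norm_nonneg _) (norm_reOp_smul_le_numRadius A hc) 2
    have him : ‖imOp (Complex.exp (θ * Complex.I) • A)‖ ^ 2 ≤ numRadius A ^ 2 := by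
      rw [imOp_eq_reOp, smul_smul]
      exact pow_le_pow_left₀ (norm_nonneg _)
        (norm_reOp_smul_le_numRadius A (by rw [norm_mul, hc]; simp)) 2
    constructor <;> linarith
  · intro h
    have hnorm (θ : ℝ) : ‖reOp (Complex.exp (θ * Complex.I) • A)‖ =
        √((1 / 4) * ‖adjoint A ∘L A + A ∘L adjoint A‖) := by
      rw [← (h θ).1, Real.sqrt_sq (norm_nonneg _)]
    have hw : numRadius A = √((1 / 4) * ‖adjoint A ∘L A + A ∘L adjoint A‖) :=
      le_antisymm (numRadius_le_of_norm_reOp_le fun θ ↦ (hnorm θ).le)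
        (hnorm 0 ▸ norm_reOp_smul_le_numRadius A (Complex.norm_exp_ofReal_mul_I 0))
    rw [hw, Real.sq_sqrt (by positivity)]
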